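/- Let p, n, θ : ℝ³ → ℝ be smooth positive functions and φ : ℝ³ → ℝ smooth, and let D^p, D^n, c^p, c^n be positive constants. Define the chemical potentials μ_p = θ(log p − c^p log θ) + φ and μ_n = θ(log n − c^n log θ) − φ, and the Onsager coefficients L_{pp} = D^p p θ, L_{nn} = D^n n θ, L_{pθ} = D^p p θ[(c^p + 1)θ + φ], L_{nθ} = D^n n θ[(c^n + 1)θ − φ]. Then the pointwise vector identities −L_{pp} ∇(μ_p/θ) + L_{pθ} ∇(1/θ) = −D^p[∇(pθ) + p∇φ] and −L_{nn} ∇(μ_n/θ) + L_{nθ} ∇(1/θ) = −D^n[∇(nθ) − n∇φ] hold; that is, the Nernst–Planck ion fluxes of the PNPF system have the Onsager form with cross coefficients L_{pn} = L_{np} = 0. -/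

import Mathlib

open MeasureTheory Filter Topology Real

noncomputable section

/-- Euclidean space ℝ³. -/
abbrev E3 : Type := EuclideanSpace ℝ (Fin 3)

/-- The `i`-th partial derivative `∂ᵢ f`. -/
def pd (i : Fin 3) (f : E3 → ℝ) (x : E3) : ℝ :=
  fderiv ℝ f x (EuclideanSpace.single i 1)

/-- Product rule for partial derivatives. -/
lemma pd_mul {f g : E3 → ℝ} {x : E3} (i : Fin 3) (hf : DifferentiableAt ℝ f x)
    (hg : DifferentiableAt ℝ g x) :
    pd i (fun y => f y * g y) x = f x * pd i g x + g x * pd i f x := by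
  simp [pd, fderiv_fun_mul hf hg]

/-- Partial derivative of a reciprocal. -/
lemma pd_one_div {f : E3 → ℝ} {x : E3} (i : Fin 3) (hf : DifferentiableAt ℝ f x)
    (hx : f x ≠ 0) :
    pd i (fun y => 1 / f y) x = -pd i f x / f x ^ 2 := by
  have h := (hasDerivAt_inv hx).comp_hasFDerivAt x hf.hasFDerivAt
  have h' : HasFDerivAt (fun y => 1 / f y) (-(f x ^ 2)⁻¹ • fderiv ℝ f x) x := by
    simpa only [one_div, Function.comp_def] using h
  simp only [pd, h'.fderiv, smul_apply, smul_eq_mul]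
  ring

/-- Partial derivative of the reduced chemical potential
`(θ (log u - c log θ) + ψ) / θ = log u - c log θ + ψ / θ`. -/
lemma pd_chemicalPotential_div {u θ ψ : E3 → ℝ} {x : E3} (c : ℝ) (i : Fin 3)
    (hu : DifferentiableAt ℝ u x) (hθ : DifferentiableAt ℝ θ x) (hψ : DifferentiableAt ℝ ψ x)
    (hux : u x ≠ 0) (hθ0 : ∀ y, θ y ≠ 0) :
    pd i (fun y => (θ y * (Real.log (u y) - c * Real.log (θ y)) + ψ y) / θ y) x
      = pd i u x / u x - c * (pd i θ x / θ x) + pd i ψ x / θ x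
        - ψ x * pd i θ x / θ x ^ 2 := by
  have hsplit : (fun y => (θ y * (Real.log (u y) - c * Real.log (θ y)) + ψ y) / θ y)
      = fun y => (Real.log (u y) - c * Real.log (θ y)) + ψ y * (θ y)⁻¹ := by
    funext y
    field_simp [hθ0 y]
  have hinv := (hasDerivAt_inv (hθ0 x)).comp_hasFDerivAt x hθ.hasFDerivAt
  have h := ((hu.hasFDerivAt.log hux).sub ((hθ.hasFDerivAt.log (hθ0 x)).const_mul c)).add
    (hψ.hasFDerivAt.mul hinv)
  have h' : HasFDerivAt
      (fun y => (Real.log (u y) - c * Real.log (θ y)) + ψ y * (θ y)⁻¹) _ x := h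
  rw [hsplit]
  simp only [pd, h'.fderiv, add_apply, sub_apply,
    smul_apply, smul_eq_mul, Function.comp_apply]
  ring

/-- Onsager form of the flux of one species with density `u` in the potential `ψ`. -/
lemma onsager_form_of_flux {u θ ψ : E3 → ℝ} {x : E3} (D c : ℝ) (i : Fin 3)
    (hu : DifferentiableAt ℝ u x) (hθ : DifferentiableAt ℝ θ x) (hψ : DifferentiableAt ℝ ψ x)
    (hux : u x ≠ 0) (hθ0 : ∀ y, θ y ≠ 0) :
    -(D * u x * θ x)
        * pd i (fun y => (θ y * (Real.log (u y) - c * Real.log (θ y)) + ψ y) / θ y) x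
        + D * u x * θ x * ((c + 1) * θ x + ψ x) * pd i (fun y => 1 / θ y) x
      = -(D * (pd i (fun y => u y * θ y) x + u x * pd i ψ x)) := by
  rw [pd_chemicalPotential_div c i hu hθ hψ hux hθ0, pd_one_div i hθ (hθ0 x), pd_mul i hu hθ]
  have := hθ0 x
  field_simp
  ring

/-- **Onsager form of the Nernst–Planck fluxes.** For smooth positive
`p, n, θ : ℝ³ → ℝ` and smooth `φ`, with chemical potentials
`μ_p = θ(log p - c^p log θ) + φ`, `μ_n = θ(log n - c^n log θ) - φ` and Onsager
coefficients `L_pp = D^p p θ`, `L_nn = D^n n θ`,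
`L_pθ = D^p p θ[(c^p+1)θ + φ]`, `L_nθ = D^n n θ[(c^n+1)θ - φ]`, one has the
pointwise vector identities
`-L_pp ∇(μ_p/θ) + L_pθ ∇(1/θ) = -D^p[∇(pθ) + p∇φ]` and
`-L_nn ∇(μ_n/θ) + L_nθ ∇(1/θ) = -D^n[∇(nθ) - n∇φ]`;
i.e. the ion fluxes have Onsager form with cross coefficients
`L_pn = L_np = 0`. -/
theorem onsager_form_of_fluxes
    (Dp Dn cp cn : ℝ) (hDp : 0 < Dp) (hDn : 0 < Dn) (hcp : 0 < cp) (hcn : 0 < cn)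
    (p n θ φ : E3 → ℝ)
    (hp : ContDiff ℝ (⊤ : ℕ∞) p) (hn : ContDiff ℝ (⊤ : ℕ∞) n) (hθ : ContDiff ℝ (⊤ : ℕ∞) θ)
    (hφ : ContDiff ℝ (⊤ : ℕ∞) φ)
    (hppos : ∀ x : E3, 0 < p x) (hnpos : ∀ x : E3, 0 < n x)
    (hθpos : ∀ x : E3, 0 < θ x)
    (μp μn : E3 → ℝ)
    (hμp : μp = fun x => θ x * (Real.log (p x) - cp * Real.log (θ x)) + φ x)
    (hμn : μn = fun x => θ x * (Real.log (n x) - cn * Real.log (θ x)) - φ x) :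
    (∀ x : E3, ∀ i : Fin 3,
      -(Dp * p x * θ x) * pd i (fun y => μp y / θ y) x
        + Dp * p x * θ x * ((cp + 1) * θ x + φ x) * pd i (fun y => 1 / θ y) x
      = -(Dp * (pd i (fun y => p y * θ y) x + p x * pd i φ x))) ∧
    (∀ x : E3, ∀ i : Fin 3,
      -(Dn * n x * θ x) * pd i (fun y => μn y / θ y) x
        + Dn * n x * θ x * ((cn + 1) * θ x - φ x) * pd i (fun y => 1 / θ y) x
      = -(Dn * (pd i (fun y => n y * θ y) x - n x * pd i φ x))) := by
  have hp' := hp.differentiable (by simp)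
  have hn' := hn.differentiable (by simp)
  have hθ' := hθ.differentiable (by simp)
  have hφ' := hφ.differentiable (by simp)
  have hθ0 : ∀ y, θ y ≠ 0 := fun y => (hθpos y).ne'
  subst hμp hμn
  refine ⟨fun x i => onsager_form_of_flux Dp cp i (hp' x) (hθ' x) (hφ' x) (hppos x).ne' hθ0,
    fun x i => ?_⟩
  have hneg : pd i (fun y => -φ y) x = -pd i φ x := by
    simp [pd, fderiv_fun_neg]
  have h := onsager_form_of_flux Dn cn i (hn' x) (hθ' x) (hφ' x).fun_neg (hnpos x).ne' hθ0
  simpa only [hneg, mul_neg, ← sub_eq_add_neg] using h
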